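/- arXiv:2105.00844 — 2 statements merged into one kernel-verified Lean document; each statement's English description precedes it below -/
import Mathlib

section
/- The α-th tail moment of ν is finite if and only if a logarithmic integrability condition on β holds: ∫_{‖x‖>1} ‖x‖^α dν(x) < ∞ ⟺ ∫_{{w ∈ S^{d-1} : β(w) < 1}} log(1/β(w)) λ(dw) < ∞. -/
open MeasureTheory Set

/-- The radial measure `e^{-b r} r^{-α-1} dr` on `(0,∞)`. -/
noncomputable def radialETaS (α b : ℝ) : Measure ℝ :=
  (volume.restrict (Set.Ioi (0:ℝ))).withDensity
    (fun r => ENNReal.ofReal (Real.exp (-b * r) * r ^ (-α - 1)))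

/-- The exponential tempered `α`-stable Lévy measure on `ℝ^d` with spherical
measure `lam` and tempering function `β`:
`ν(E) = ∫_{S^{d-1}} ∫_0^∞ 1_E(r w) e^{-β(w) r} r^{-α-1} dr λ(dw)`. -/
noncomputable def etas (d : ℕ) (α : ℝ) (lam : Measure (EuclideanSpace ℝ (Fin d)))
    (β : EuclideanSpace ℝ (Fin d) → ℝ) : Measure (EuclideanSpace ℝ (Fin d)) :=
  lam.bind (fun w => (radialETaS α (β w)).map (fun r : ℝ => r • w))

lemma lintegral_Ioc_inv_aux (b : ℝ) (hb : 0 < b) :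
    ∫⁻ r in Ioc (1:ℝ) (1 / b), ENNReal.ofReal (r⁻¹) = ENNReal.ofReal (Real.log (1 / b)) := by
  rcases le_total 1 (1 / b) with h | h
  · rw [← ofReal_integral_eq_lintegral_ofReal, ← intervalIntegral.integral_of_le h,
      integral_inv_of_pos one_pos (by positivity), div_one]
    · have : IntervalIntegrable (fun r : ℝ => r⁻¹) volume 1 (1 / b) := by
        apply intervalIntegral.intervalIntegrable_inv (f := fun r => r)
        · intro x hx
          rw [uIcc_of_le h] at hx
          have := hx.1
          simp only [ne_eq]; linarith
        · fun_prop
      exact (intervalIntegrable_iff_integrableOn_Ioc_of_le h).1 this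
    · filter_upwards [ae_restrict_mem measurableSet_Ioc] with r hr
      have := hr.1
      simp only [Pi.zero_apply]; positivity
  · rw [Ioc_eq_empty (by simpa using h), ENNReal.ofReal_of_nonpos (Real.log_nonpos (by positivity) h)]
    simp

lemma lintegral_exp_aux (b : ℝ) (hb : 0 < b) :
    ∫⁻ r in Ioi (0:ℝ), ENNReal.ofReal (b * Real.exp (-b * r)) = 1 := by
  rw [← ofReal_integral_eq_lintegral_ofReal]
  · rw [integral_const_mul, integral_exp_mul_Ioi (by linarith)]
    simp [hb.ne']
  · exact (integrableOn_exp_mul_Ioi (by linarith) 0).const_mul b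
  · filter_upwards with r
    simp only [Pi.zero_apply]; positivity

lemma radial_upper_aux (b : ℝ) (hb : 0 < b) :
    ∫⁻ r in Ioi (1:ℝ), ENNReal.ofReal (Real.exp (-b * r) * r⁻¹)
      ≤ ENNReal.ofReal (Real.log (1 / b)) + 1 := by
  calc ∫⁻ r in Ioi (1:ℝ), ENNReal.ofReal (Real.exp (-b * r) * r⁻¹)
      ≤ ∫⁻ r in Ioc (1:ℝ) (1 / b) ∪ Ioi (max 1 (1 / b)),
          ENNReal.ofReal (Real.exp (-b * r) * r⁻¹) := by
        apply lintegral_mono_set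
        intro r hr
        rcases le_or_gt r (1 / b) with h | h
        · exact Or.inl ⟨hr, h⟩
        · exact Or.inr (max_lt hr h)
    _ ≤ (∫⁻ r in Ioc (1:ℝ) (1 / b), ENNReal.ofReal (Real.exp (-b * r) * r⁻¹)) +
        ∫⁻ r in Ioi (max 1 (1 / b)), ENNReal.ofReal (Real.exp (-b * r) * r⁻¹) :=
        lintegral_union_le _ _ _
    _ ≤ (∫⁻ r in Ioc (1:ℝ) (1 / b), ENNReal.ofReal (r⁻¹)) +
        ∫⁻ r in Ioi (0:ℝ), ENNReal.ofReal (b * Real.exp (-b * r)) := by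
        gcongr ?_ + ?_
        · apply setLIntegral_mono' measurableSet_Ioc
          intro r hr
          have h1 := hr.1
          apply ENNReal.ofReal_le_ofReal
          have h2 : Real.exp (-b * r) ≤ 1 := Real.exp_le_one_iff.2 (by nlinarith)
          exact mul_le_of_le_one_left (by positivity) h2
        · refine le_trans (setLIntegral_mono' measurableSet_Ioi ?_)
            (lintegral_mono_set (Ioi_subset_Ioi (le_max_of_le_left zero_le_one)))
          intro r hr
          have h1 : 1 / b < r := lt_of_le_of_lt (le_max_right _ _) hr
          apply ENNReal.ofReal_le_ofReal
          rw [mul_comm b]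
          gcongr
          have h3 : 0 < 1 / b := by positivity
          rw [← inv_inv b]
          gcongr
          simpa using h1.le
    _ = _ := by rw [lintegral_Ioc_inv_aux b hb, lintegral_exp_aux b hb]

lemma radial_lower_aux (b : ℝ) (hb : 0 < b) :
    ENNReal.ofReal (Real.exp (-1)) * ENNReal.ofReal (Real.log (1 / b)) ≤
    ∫⁻ r in Ioi (1:ℝ), ENNReal.ofReal (Real.exp (-b * r) * r⁻¹) := by
  rw [← lintegral_Ioc_inv_aux b hb, ← lintegral_const_mul _ (by fun_prop)]
  refine le_trans (setLIntegral_mono' measurableSet_Ioc ?_)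
    (lintegral_mono_set Ioc_subset_Ioi_self)
  intro r hr
  have h1 := hr.1
  have h2 : b * r ≤ 1 := by
    have := hr.2
    rw [le_div_iff₀ hb] at this
    linarith
  rw [← ENNReal.ofReal_mul (by positivity)]
  apply ENNReal.ofReal_le_ofReal
  gcongr
  linarith

lemma measurable_kernel_aux (d : ℕ) (α : ℝ)
    (β : EuclideanSpace ℝ (Fin d) → ℝ) (hβ : Measurable β) :
    Measurable (fun w : EuclideanSpace ℝ (Fin d) =>
      (radialETaS α (β w)).map (fun r : ℝ => r • w)) := by
  apply Measure.measurable_of_measurable_coe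
  intro s hs
  have key : ∀ w : EuclideanSpace ℝ (Fin d),
      ((radialETaS α (β w)).map (fun r : ℝ => r • w)) s =
      ∫⁻ r in Ioi (0:ℝ), ((fun p : EuclideanSpace ℝ (Fin d) × ℝ => p.2 • p.1) ⁻¹' s).indicator
        (fun p => ENNReal.ofReal (Real.exp (-β p.1 * p.2) * p.2 ^ (-α - 1))) (w, r) := by
    intro w
    have hm : Measurable (fun r : ℝ => r • w) := by fun_prop
    rw [Measure.map_apply hm hs, radialETaS, withDensity_apply _ (hm hs),
      ← lintegral_indicator (hm hs)]
    rfl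
  simp_rw [key]
  apply Measurable.lintegral_prod_right'
  apply Measurable.indicator
  · fun_prop
  · exact (by fun_prop : Measurable (fun p : EuclideanSpace ℝ (Fin d) × ℝ => p.2 • p.1)) hs

lemma tail_eq_aux (d : ℕ) (α b : ℝ) (w : EuclideanSpace ℝ (Fin d)) (hw : ‖w‖ = 1) :
    ∫⁻ x, ({x : EuclideanSpace ℝ (Fin d) | 1 < ‖x‖}).indicator
      (fun x => ENNReal.ofReal (‖x‖ ^ α)) x ∂((radialETaS α b).map (fun r : ℝ => r • w)) =
    ∫⁻ r in Ioi (1:ℝ), ENNReal.ofReal (Real.exp (-b * r) * r⁻¹) := by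
  have hS : MeasurableSet {x : EuclideanSpace ℝ (Fin d) | 1 < ‖x‖} :=
    measurableSet_lt measurable_const measurable_norm
  have hf : Measurable (({x : EuclideanSpace ℝ (Fin d) | 1 < ‖x‖}).indicator
      (fun x => ENNReal.ofReal (‖x‖ ^ α))) := Measurable.indicator (by fun_prop) hS
  have hm : Measurable (fun r : ℝ => r • w) := by fun_prop
  have hc := hf.comp hm
  simp only [Function.comp_def] at hc
  rw [lintegral_map hf hm, radialETaS,
    lintegral_withDensity_eq_lintegral_mul _ (by fun_prop) hc,
    ← lintegral_indicator measurableSet_Ioi, ← lintegral_indicator measurableSet_Ioi]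
  congr 1
  ext r
  by_cases h0 : 0 < r
  · by_cases h1 : 1 < r
    · simp only [indicator, mem_Ioi, h0, h1, if_true, Pi.mul_apply, Function.comp, mem_setOf_eq,
        norm_smul, hw, mul_one, Real.norm_eq_abs, abs_of_pos h0]
      rw [← ENNReal.ofReal_mul (by positivity), mul_assoc, ← Real.rpow_add h0,
        show -α - 1 + α = -1 by ring, Real.rpow_neg_one]
    · simp [indicator, h0, h1, norm_smul, hw, abs_of_pos h0]
  · have h1 : ¬ 1 < r := by linarith
    simp [indicator, h0, h1]

/-- the `α`-th tail moment of `ν` is finite iff a logarithmic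
integrability condition on `β` holds:
`∫_{‖x‖>1} ‖x‖^α dν < ∞ ↔ ∫_{{w ∈ S^{d-1} : β(w) < 1}} log(1/β(w)) dλ(w) < ∞`. -/
theorem etas_tailMoment_alpha_iff
    (d : ℕ) (hd : 1 ≤ d) (α : ℝ) (hα : α ∈ Set.Ioo (0:ℝ) 2)
    (lam : Measure (EuclideanSpace ℝ (Fin d))) [IsFiniteMeasure lam]
    (hlam : lam (Metric.sphere (0 : EuclideanSpace ℝ (Fin d)) 1)ᶜ = 0)
    (β : EuclideanSpace ℝ (Fin d) → ℝ) (hβ : Measurable β)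
    (hβpos : ∀ w ∈ Metric.sphere (0 : EuclideanSpace ℝ (Fin d)) 1, 0 < β w) :
    (∫⁻ x in {x : EuclideanSpace ℝ (Fin d) | 1 < ‖x‖}, ENNReal.ofReal (‖x‖ ^ α)
        ∂(etas d α lam β)) < ⊤ ↔
      (∫⁻ w in {w ∈ Metric.sphere (0 : EuclideanSpace ℝ (Fin d)) 1 | β w < 1},
        ENNReal.ofReal (Real.log (1 / β w)) ∂lam) < ⊤ := by
  have hS : MeasurableSet {x : EuclideanSpace ℝ (Fin d) | 1 < ‖x‖} :=
    measurableSet_lt measurable_const measurable_norm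
  have hf : Measurable (({x : EuclideanSpace ℝ (Fin d) | 1 < ‖x‖}).indicator
      (fun x => ENNReal.ofReal (‖x‖ ^ α))) := Measurable.indicator (by fun_prop) hS
  have hae : ∀ᵐ w ∂lam, w ∈ Metric.sphere (0 : EuclideanSpace ℝ (Fin d)) 1 := hlam
  have hL : (∫⁻ x in {x : EuclideanSpace ℝ (Fin d) | 1 < ‖x‖}, ENNReal.ofReal (‖x‖ ^ α)
        ∂(etas d α lam β)) =
      ∫⁻ w, (∫⁻ r in Ioi (1:ℝ), ENNReal.ofReal (Real.exp (-β w * r) * r⁻¹)) ∂lam := by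
    rw [← lintegral_indicator hS, etas,
      Measure.lintegral_bind (measurable_kernel_aux d α β hβ).aemeasurable hf.aemeasurable]
    apply lintegral_congr_ae
    filter_upwards [hae] with w hw
    exact tail_eq_aux d α (β w) w (by simpa using hw)
  have hT : MeasurableSet {w ∈ Metric.sphere (0 : EuclideanSpace ℝ (Fin d)) 1 | β w < 1} :=
    Metric.isClosed_sphere.measurableSet.inter (measurableSet_lt hβ measurable_const)
  have hR : (∫⁻ w in {w ∈ Metric.sphere (0 : EuclideanSpace ℝ (Fin d)) 1 | β w < 1},
        ENNReal.ofReal (Real.log (1 / β w)) ∂lam) =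
      ∫⁻ w, ENNReal.ofReal (Real.log (1 / β w)) ∂lam := by
    rw [← lintegral_indicator hT]
    apply lintegral_congr_ae
    filter_upwards [hae] with w hw
    by_cases h : β w < 1
    · rw [indicator_of_mem (show w ∈ {w ∈ Metric.sphere (0 : EuclideanSpace ℝ (Fin d)) 1 | β w < 1}
        from ⟨hw, h⟩)]
    · rw [indicator_of_notMem (fun h' => h h'.2), ENNReal.ofReal_of_nonpos]
      have hb := hβpos w hw
      apply Real.log_nonpos (by positivity)
      rw [div_le_one hb]
      linarith
  have hmlog : Measurable (fun w => ENNReal.ofReal (Real.log (1 / β w))) := by fun_prop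
  rw [hL, hR]
  constructor
  · intro h
    have h1 : ENNReal.ofReal (Real.exp (-1)) * ∫⁻ w, ENNReal.ofReal (Real.log (1 / β w)) ∂lam
        < ⊤ := by
      rw [← lintegral_const_mul _ hmlog]
      refine lt_of_le_of_lt (lintegral_mono_ae ?_) h
      filter_upwards [hae] with w hw
      exact radial_lower_aux (β w) (hβpos w hw)
    refine ENNReal.lt_top_of_mul_ne_top_right h1.ne ?_
    simp [Real.exp_pos]
  · intro h
    calc _ ≤ ∫⁻ w, (ENNReal.ofReal (Real.log (1 / β w)) + 1) ∂lam := by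
          apply lintegral_mono_ae
          filter_upwards [hae] with w hw
          exact radial_upper_aux (β w) (hβpos w hw)
      _ = (∫⁻ w, ENNReal.ofReal (Real.log (1 / β w)) ∂lam) + lam univ := by
          rw [lintegral_add_left hmlog]; simp
      _ < ⊤ := ENNReal.add_lt_top.2 ⟨h, measure_lt_top _ _⟩
end

section
/- For α ∈ (1,2), β > 0 and z ∈ ℝ, the function r ↦ (e^{izr} − 1 − izr) e^{−βr} r^{−α−1} is Bochner integrable on (0,∞) with values in ℂ, and ∫_0^∞ (e^{izr} − 1 − izr) e^{−βr} r^{−α−1} dr = Γ(−α) · ((β − iz)^α − β^α + izα β^{α−1}), where the complex powers are taken with the principal branch (well defined since Re(β − iz) = β > 0). -/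
open MeasureTheory Set Complex

lemma etas_aux_int (s : ℝ) (hs : -1 < s) (b : ℝ) (hb : 0 < b) :
    IntegrableOn (fun r : ℝ => r ^ s * Real.exp (-b * r)) (Ioi 0) := by
  simpa using integrableOn_rpow_mul_exp_neg_mul_rpow (p := 1) hs one_pos hb

lemma etas_aux_meas (s : ℝ) (w : ℂ) :
    AEStronglyMeasurable (fun r : ℝ => ((r ^ s : ℝ) : ℂ) * Complex.exp (-w * r))
      (volume.restrict (Ioi 0)) := by
  apply Measurable.aestronglyMeasurable
  fun_prop

lemma etas_aux_norm (s : ℝ) (w : ℂ) (r : ℝ) (hr : 0 < r) :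
    ‖((r ^ s : ℝ) : ℂ) * Complex.exp (-w * r)‖ = r ^ s * Real.exp (-w.re * r) := by
  rw [norm_mul, Complex.norm_real, Complex.norm_exp, Real.norm_of_nonneg (by positivity)]
  simp

lemma etas_aux_cint (s : ℝ) (hs : -1 < s) (w : ℂ) (hw : 0 < w.re) :
    IntegrableOn (fun r : ℝ => ((r ^ s : ℝ) : ℂ) * Complex.exp (-w * r)) (Ioi 0) := by
  refine Integrable.mono' (etas_aux_int s hs w.re hw) (etas_aux_meas s w) ?_
  filter_upwards [ae_restrict_mem measurableSet_Ioi] with r hr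
  exact (etas_aux_norm s w r hr).le

lemma etas_aux_diff (s : ℝ) (hs : -1 < s) (w : ℂ) (hw : 0 < w.re) :
    DifferentiableAt ℂ
      (fun w : ℂ => ∫ r in Ioi (0:ℝ), ((r ^ s : ℝ) : ℂ) * Complex.exp (-w * r)) w := by
  have hw2 : 0 < w.re / 2 := by linarith
  have key := hasDerivAt_integral_of_dominated_loc_of_deriv_le
    (μ := volume.restrict (Ioi (0:ℝ))) (𝕜 := ℂ)
    (F := fun (w : ℂ) (r : ℝ) => ((r ^ s : ℝ) : ℂ) * Complex.exp (-w * r))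
    (F' := fun (w : ℂ) (r : ℝ) => ((r ^ s : ℝ) : ℂ) * (Complex.exp (-w * r) * (-1 * r)))
    (bound := fun r => r ^ (s + 1) * Real.exp (-(w.re / 2) * r))
    (x₀ := w) (s := Metric.ball w (w.re / 2)) (Metric.ball_mem_nhds w hw2)
    (Filter.Eventually.of_forall fun w => etas_aux_meas s w) (etas_aux_cint s hs w hw)
    (by apply Measurable.aestronglyMeasurable; fun_prop) ?_
    (etas_aux_int (s + 1) (by linarith) _ hw2) ?_
  · exact key.2.differentiableAt
  · filter_upwards [ae_restrict_mem measurableSet_Ioi] with r hr v hv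
    have hr' : 0 < r := hr
    rw [← mul_assoc, norm_mul, etas_aux_norm s v r hr', Real.rpow_add_one hr'.ne']
    have h1 : |(v - w).re| < w.re / 2 :=
      (Complex.abs_re_le_norm _).trans_lt (by simpa [dist_eq_norm] using hv)
    rw [abs_lt, Complex.sub_re] at h1
    have h2 : ‖(-1 * (r:ℂ))‖ = r := by simp [abs_of_pos hr']
    rw [h2]
    have h3 : Real.exp (-v.re * r) ≤ Real.exp (-(w.re / 2) * r) := by
      apply Real.exp_le_exp.2
      nlinarith [h1.1, h1.2]
    calc r ^ s * Real.exp (-v.re * r) * r = (r ^ s * r) * Real.exp (-v.re * r) := by ring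
      _ ≤ _ := by gcongr
  · filter_upwards with r v _
    have : HasDerivAt (fun v : ℂ => -v * r) (-1 * r) v :=
      (hasDerivAt_id v).neg.mul_const _
    exact (this.cexp).const_mul _

lemma etas_aux_gamma (s : ℝ) (hs : -1 < s) (w : ℂ) (hw : 0 < w.re) :
    ∫ r in Ioi (0:ℝ), ((r ^ s : ℝ) : ℂ) * Complex.exp (-w * r)
      = (Real.Gamma (s + 1) : ℂ) * w ^ (-((s:ℂ) + 1)) := by
  let U : Set ℂ := {w | 0 < w.re}
  have hU : IsOpen U := isOpen_lt continuous_const Complex.continuous_re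
  have hUc : IsPreconnected U := (convex_halfSpace_re_gt 0).isPreconnected
  have hf : AnalyticOnNhd ℂ
      (fun w : ℂ => ∫ r in Ioi (0:ℝ), ((r ^ s : ℝ) : ℂ) * Complex.exp (-w * r)) U :=
    DifferentiableOn.analyticOnNhd
      (fun w hw => (etas_aux_diff s hs w hw).differentiableWithinAt) hU
  have hg : AnalyticOnNhd ℂ
      (fun w : ℂ => (Real.Gamma (s + 1) : ℂ) * w ^ (-((s:ℂ) + 1))) U := by
    apply DifferentiableOn.analyticOnNhd _ hU
    intro w hw
    apply DifferentiableAt.differentiableWithinAt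
    refine DifferentiableAt.const_mul ?_ _
    exact (differentiableAt_id).cpow_const (Or.inl hw)
  have hreal : ∀ b : ℝ, 0 < b →
      ∫ r in Ioi (0:ℝ), ((r ^ s : ℝ) : ℂ) * Complex.exp (-(b:ℂ) * r)
      = (Real.Gamma (s + 1) : ℂ) * (b:ℂ) ^ (-((s:ℂ) + 1)) := by
    intro b hb
    have h := Real.integral_rpow_mul_exp_neg_mul_Ioi (a := s + 1) (r := b) (by linarith) hb
    have h' := congrArg (fun x : ℝ => (x : ℂ)) h
    simp only [← integral_complex_ofReal] at h'
    have h1 : ((1 / b) ^ (s + 1) : ℝ) = b ^ (-(s + 1)) := by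
      rw [one_div, Real.inv_rpow hb.le, Real.rpow_neg hb.le]
    rw [h1] at h'
    push_cast [Complex.ofReal_cpow hb.le] at h'
    rw [mul_comm, ← h']
    refine setIntegral_congr_fun measurableSet_Ioi fun r hr => ?_
    simp
  have hfreq : ∃ᶠ z in nhdsWithin (1:ℂ) {1}ᶜ,
      (∫ r in Ioi (0:ℝ), ((r ^ s : ℝ) : ℂ) * Complex.exp (-z * r))
      = (Real.Gamma (s + 1) : ℂ) * z ^ (-((s:ℂ) + 1)) := by
    have ht : Filter.Tendsto (fun x : ℝ => (x : ℂ)) (nhdsWithin 1 (Ioi 1))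
        (nhdsWithin (1:ℂ) {1}ᶜ) := by
      apply tendsto_nhdsWithin_of_tendsto_nhds_of_eventually_within
      · exact (Complex.continuous_ofReal.tendsto' 1 1 (by simp)).mono_left nhdsWithin_le_nhds
      · filter_upwards [self_mem_nhdsWithin] with x hx
        have : (1:ℝ) < x := hx
        simp only [mem_compl_iff, mem_singleton_iff]
        exact_mod_cast this.ne'
    refine ht.frequently (Filter.Eventually.frequently ?_)
    filter_upwards [self_mem_nhdsWithin] with x hx
    exact hreal x (lt_trans one_pos hx)
  exact hf.eqOn_of_preconnected_of_frequently_eq hg hUc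
    (show (1:ℂ) ∈ U by simp [U]) hfreq hw

lemma etas_exp_bound (x : ℝ) : ‖Complex.exp (I * x) - 1 - I * x‖ ≤ 3 * x ^ 2 := by
  have hn : ‖I * (x:ℂ)‖ = |x| := by simp
  rcases le_or_gt |x| 1 with h | h
  · have := Complex.norm_exp_sub_one_sub_id_le (x := I * x) (by rw [hn]; exact h)
    rw [hn, sq_abs] at this
    nlinarith [sq_nonneg x]
  · have h1 : ‖Complex.exp (I * x) - 1‖ ≤ |x| := by
      simpa using Real.norm_exp_I_mul_ofReal_sub_one_le (x := x)
    have h2 := norm_sub_le (Complex.exp (I * x) - 1) (I * x)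
    rw [hn] at h2
    rw [← sq_abs]
    nlinarith

lemma etas_g_factor (β z r : ℝ) :
    Complex.exp (-((β:ℂ) - z * I) * r) = Complex.exp (I * (z * r : ℝ)) * (Real.exp (-β * r) : ℂ) := by
  rw [Complex.ofReal_exp, ← Complex.exp_add]
  congr 1
  push_cast
  ring

lemma etas_b_factor (β r : ℝ) :
    Complex.exp (-(β:ℂ) * r) = (Real.exp (-β * r) : ℂ) := by
  rw [Complex.ofReal_exp]
  congr 1
  push_cast
  ring

noncomputable def etasG (β z : ℝ) (r : ℝ) : ℂ :=
  Complex.exp (-((β:ℂ) - z * I) * r) - Complex.exp (-(β:ℂ) * r)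
    - I * z * r * Complex.exp (-(β:ℂ) * r)

noncomputable def etasG1 (β z : ℝ) (r : ℝ) : ℂ :=
  -((β:ℂ) - z * I) * Complex.exp (-((β:ℂ) - z * I) * r) + β * Complex.exp (-(β:ℂ) * r)
    - I * z * Complex.exp (-(β:ℂ) * r) + I * z * β * r * Complex.exp (-(β:ℂ) * r)

noncomputable def etasG2 (β z : ℝ) (r : ℝ) : ℂ :=
  ((β:ℂ) - z * I) ^ 2 * Complex.exp (-((β:ℂ) - z * I) * r) - β ^ 2 * Complex.exp (-(β:ℂ) * r)
    + 2 * I * z * β * Complex.exp (-(β:ℂ) * r) - I * z * β ^ 2 * r * Complex.exp (-(β:ℂ) * r)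

lemma etas_hasDerivAt_exp (w : ℂ) (r : ℝ) :
    HasDerivAt (fun r : ℝ => Complex.exp (-w * r)) (Complex.exp (-w * r) * (-w * 1)) r :=
  ((Complex.ofRealCLM.hasDerivAt (x := r)).const_mul (-w)).cexp

lemma etas_hasDerivAt_id (r : ℝ) : HasDerivAt (fun r : ℝ => (r:ℂ)) 1 r :=
  Complex.ofRealCLM.hasDerivAt

lemma etasG_deriv (β z r : ℝ) : HasDerivAt (etasG β z) (etasG1 β z r) r := by
  have h1 := etas_hasDerivAt_exp ((β:ℂ) - z * I) r
  have h2 := etas_hasDerivAt_exp (β:ℂ) r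
  have h3 := etas_hasDerivAt_id r
  have h := (h1.sub h2).sub ((h3.const_mul (I * z)).mul h2)
  unfold etasG
  refine h.congr_deriv ?_
  unfold etasG1
  ring

lemma etasG1_deriv (β z r : ℝ) : HasDerivAt (etasG1 β z) (etasG2 β z r) r := by
  have h1 := etas_hasDerivAt_exp ((β:ℂ) - z * I) r
  have h2 := etas_hasDerivAt_exp (β:ℂ) r
  have h3 := etas_hasDerivAt_id r
  have h := (((h1.const_mul (-((β:ℂ) - z * I))).add (h2.const_mul (β:ℂ))).sub
    (h2.const_mul (I * z))).add ((h3.const_mul (I * z * β)).mul h2)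
  unfold etasG1
  refine h.congr_deriv ?_
  unfold etasG2
  ring

lemma etasG_bound (β z r : ℝ) :
    ‖etasG β z r‖ ≤ 3 * z ^ 2 * r ^ 2 * Real.exp (-β * r) := by
  have : etasG β z r = (Complex.exp (I * (z * r : ℝ)) - 1 - I * (z * r : ℝ)) *
      (Real.exp (-β * r) : ℂ) := by
    unfold etasG
    rw [etas_g_factor, etas_b_factor]
    push_cast
    ring
  rw [this, norm_mul, Complex.norm_real, Real.norm_of_nonneg (Real.exp_pos _).le]
  gcongr
  refine (etas_exp_bound (z * r)).trans (le_of_eq (by ring))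

lemma etasG1_bound (β z r : ℝ) (hr : 0 ≤ r) :
    ‖etasG1 β z r‖ ≤ (‖(β:ℂ) - z * I‖ * |z| + |z * β|) * r * Real.exp (-β * r) := by
  have : etasG1 β z r = (-((β:ℂ) - z * I) * (Complex.exp (I * (z * r : ℝ)) - 1)
      + I * ((z * β * r : ℝ) : ℂ)) * (Real.exp (-β * r) : ℂ) := by
    unfold etasG1
    rw [etas_g_factor, etas_b_factor]
    push_cast
    ring
  rw [this, norm_mul, Complex.norm_real, Real.norm_of_nonneg (Real.exp_pos _).le]
  gcongr
  refine (norm_add_le _ _).trans ?_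
  have h1 : ‖Complex.exp (I * (z * r : ℝ)) - 1‖ ≤ |z| * r := by
    have := Real.norm_exp_I_mul_ofReal_sub_one_le (x := z * r)
    rwa [Real.norm_eq_abs, abs_mul, abs_of_nonneg hr] at this
  have h2 : ‖I * ((z * β * r : ℝ) : ℂ)‖ = |z * β| * r := by
    rw [norm_mul, Complex.norm_I, one_mul, Complex.norm_real, Real.norm_eq_abs, abs_mul,
      abs_of_nonneg hr]
  rw [h2, norm_mul, norm_neg]
  nlinarith [mul_le_mul_of_nonneg_left h1 (norm_nonneg ((β:ℂ) - z * I))]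

lemma etas_rpow_deriv (p r : ℝ) (hr : 0 < r) :
    HasDerivAt (fun r : ℝ => ((r ^ p : ℝ) : ℂ)) ((p * r ^ (p - 1) : ℝ) : ℂ) r :=
  (Real.hasDerivAt_rpow_const (Or.inl hr.ne')).ofReal_comp

noncomputable def etasH (α β z : ℝ) (r : ℝ) : ℂ :=
  (-1 / α : ℂ) * (etasG β z r * ((r ^ (-α) : ℝ) : ℂ)) +
    (-1 / (α * (α - 1)) : ℂ) * (etasG1 β z r * ((r ^ (1 - α) : ℝ) : ℂ))

lemma etasH_deriv (α β z r : ℝ) (hα : α ∈ Set.Ioo (1:ℝ) 2) (hr : 0 < r) :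
    HasDerivAt (etasH α β z) (etasG β z r * ((r ^ (-α - 1) : ℝ) : ℂ)
      - (1 / (α * (α - 1)) : ℂ) * (etasG2 β z r * ((r ^ (1 - α) : ℝ) : ℂ))) r := by
  have h := (((etasG_deriv β z r).mul (etas_rpow_deriv (-α) r hr)).const_mul (-1 / α : ℂ)).add
    (((etasG1_deriv β z r).mul (etas_rpow_deriv (1 - α) r hr)).const_mul
      (-1 / (α * (α - 1)) : ℂ))
  refine h.congr_deriv ?_
  have h0 : (α:ℂ) ≠ 0 := by
    have := hα.1
    exact_mod_cast (by linarith : (0:ℝ) < α).ne'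
  have h1 : (α:ℂ) - 1 ≠ 0 := by
    have := hα.1
    exact_mod_cast (by linarith : (0:ℝ) < α - 1).ne'
  rw [show (1 - α - 1 : ℝ) = -α by ring]
  push_cast
  field_simp
  ring

lemma etasH_bound (α β z : ℝ) : ∃ C : ℝ, ∀ r : ℝ, 0 < r →
    ‖etasH α β z r‖ ≤ C * (r ^ (2 - α) * Real.exp (-β * r)) := by
  refine ⟨‖(-1 / α : ℂ)‖ * (3 * z ^ 2) + ‖(-1 / (α * (α - 1)) : ℂ)‖ *
    (‖(β:ℂ) - z * I‖ * |z| + |z * β|), fun r hr => ?_⟩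
  have e1 : r ^ (2 - α) = r ^ 2 * r ^ (-α) := by
    rw [← Real.rpow_natCast, ← Real.rpow_add hr]; congr 1
  have e2 : r ^ (2 - α) = r * r ^ (1 - α) := by
    rw [mul_comm, ← Real.rpow_add_one hr.ne']; congr 1; ring
  unfold etasH
  refine (norm_add_le _ _).trans ?_
  rw [norm_mul, norm_mul, norm_mul, norm_mul, Complex.norm_real, Complex.norm_real,
    Real.norm_of_nonneg (by positivity), Real.norm_of_nonneg (by positivity), add_mul]
  have p1 : 0 ≤ r ^ (-α) := by positivity
  have p2 : 0 ≤ r ^ (1 - α) := by positivity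
  apply add_le_add
  · rw [mul_assoc]
    refine mul_le_mul_of_nonneg_left ?_ (norm_nonneg _)
    rw [e1]
    calc _ ≤ (3 * z ^ 2 * r ^ 2 * Real.exp (-β * r)) * r ^ (-α) :=
          mul_le_mul_of_nonneg_right (etasG_bound β z r) p1
      _ = _ := by ring
  · rw [mul_assoc]
    refine mul_le_mul_of_nonneg_left ?_ (norm_nonneg _)
    rw [e2]
    calc _ ≤ ((‖(β:ℂ) - z * I‖ * |z| + |z * β|) * r * Real.exp (-β * r)) * r ^ (1 - α) :=
          mul_le_mul_of_nonneg_right (etasG1_bound β z r hr.le) p2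
      _ = _ := by ring

lemma etasH_zero (α β z : ℝ) (hα : α ∈ Set.Ioo (1:ℝ) 2) : etasH α β z 0 = 0 := by
  unfold etasH
  have := hα.1
  rw [Real.zero_rpow (by linarith), Real.zero_rpow (by linarith)]
  simp

lemma etasH_cont (α β z : ℝ) (hα : α ∈ Set.Ioo (1:ℝ) 2) :
    ContinuousWithinAt (etasH α β z) (Ici 0) 0 := by
  obtain ⟨C, hC⟩ := etasH_bound α β z
  have h2 := hα.2
  rw [ContinuousWithinAt, etasH_zero α β z hα]
  apply squeeze_zero_norm' (a := fun r : ℝ => C * (r ^ (2 - α) * Real.exp (-β * r)))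
  · filter_upwards [self_mem_nhdsWithin] with r hr
    rcases (show (0:ℝ) ≤ r from hr).eq_or_lt with h | h
    · rw [← h, etasH_zero α β z hα, Real.zero_rpow (by linarith)]; simp
    · exact hC r h
  · have : Continuous (fun r : ℝ => C * (r ^ (2 - α) * Real.exp (-β * r))) := by
      have : Continuous (fun r : ℝ => r ^ (2 - α)) := Real.continuous_rpow_const (by linarith)
      fun_prop
    refine (this.tendsto' 0 0 ?_).mono_left nhdsWithin_le_nhds
    rw [Real.zero_rpow (by linarith)]; simp

lemma etasH_top (α β z : ℝ) (hβ : 0 < β) :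
    Filter.Tendsto (etasH α β z) Filter.atTop (nhds 0) := by
  obtain ⟨C, hC⟩ := etasH_bound α β z
  apply squeeze_zero_norm' (a := fun r : ℝ => C * (r ^ (2 - α) * Real.exp (-β * r)))
  · filter_upwards [Filter.eventually_gt_atTop 0] with r hr using hC r hr
  · simpa using (tendsto_rpow_mul_exp_neg_mul_atTop_nhds_zero (2 - α) β hβ).const_mul C

lemma etasG_int (α β z : ℝ) (hα : α ∈ Set.Ioo (1:ℝ) 2) (hβ : 0 < β) :
    IntegrableOn (fun r : ℝ => etasG β z r * ((r ^ (-α - 1) : ℝ) : ℂ)) (Ioi 0) := by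
  have h2 := hα.2
  refine Integrable.mono' ((etas_aux_int (1 - α) (by linarith) β hβ).const_mul (3 * z ^ 2)) ?_ ?_
  · apply Measurable.aestronglyMeasurable
    unfold etasG
    fun_prop
  · filter_upwards [ae_restrict_mem measurableSet_Ioi] with r hr
    have hr : 0 < r := hr
    have e1 : r ^ (1 - α) = r ^ 2 * r ^ (-α - 1) := by
      rw [← Real.rpow_natCast, ← Real.rpow_add hr]; congr 1; push_cast; ring
    have p1 : 0 ≤ r ^ (-α - 1) := by positivity
    rw [norm_mul, Complex.norm_real, Real.norm_of_nonneg p1, e1]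
    calc _ ≤ (3 * z ^ 2 * r ^ 2 * Real.exp (-β * r)) * r ^ (-α - 1) :=
          mul_le_mul_of_nonneg_right (etasG_bound β z r) p1
      _ = _ := by ring

lemma etasG2_int (α β z : ℝ) (hα : α ∈ Set.Ioo (1:ℝ) 2) (hβ : 0 < β) :
    IntegrableOn (fun r : ℝ => etasG2 β z r * ((r ^ (1 - α) : ℝ) : ℂ)) (Ioi 0) ∧
    ∫ r in Ioi (0:ℝ), etasG2 β z r * ((r ^ (1 - α) : ℝ) : ℂ) =
      (Real.Gamma (2 - α) : ℂ) * (((β : ℂ) - z * Complex.I) ^ (α : ℂ) - (β : ℂ) ^ (α : ℂ)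
            + Complex.I * z * α * ((β ^ (α - 1) : ℝ) : ℂ)) := by
  have h2 := hα.2
  set w : ℂ := (β:ℂ) - z * I with hw
  have hwre : 0 < w.re := by simp [hw, hβ]
  have hbre : 0 < (β:ℂ).re := by simpa using hβ
  have i1 := etas_aux_cint (1 - α) (by linarith) w hwre
  have i2 := etas_aux_cint (1 - α) (by linarith) β hbre
  have i3 := etas_aux_cint (2 - α) (by linarith) β hbre
  have v1 := etas_aux_gamma (1 - α) (by linarith) w hwre
  have v2 := etas_aux_gamma (1 - α) (by linarith) β hbre
  have v3 := etas_aux_gamma (2 - α) (by linarith) β hbre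
  have hEq : EqOn (fun r : ℝ => etasG2 β z r * ((r ^ (1 - α) : ℝ) : ℂ))
      (fun r : ℝ => (w ^ 2 * (((r ^ (1 - α) : ℝ) : ℂ) * Complex.exp (-w * r))
        + (-β ^ 2 + 2 * I * z * β) * (((r ^ (1 - α) : ℝ) : ℂ) * Complex.exp (-(β:ℂ) * r)))
        + (-I * z * β ^ 2) * (((r ^ (2 - α) : ℝ) : ℂ) * Complex.exp (-(β:ℂ) * r)))
      (Ioi 0) := by
    intro r hr
    have hr : 0 < r := hr
    have e2 : r ^ (2 - α) = r ^ (1 - α) * r := by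
      rw [← Real.rpow_add_one hr.ne']; congr 1; ring
    simp only [etasG2, e2, ← hw]
    push_cast
    ring
  have j1 := i1.const_mul (w ^ 2)
  have j2 := i2.const_mul (-(β:ℂ) ^ 2 + 2 * I * z * β)
  have j3 := i3.const_mul (-I * z * (β:ℂ) ^ 2)
  have j12 : Integrable (fun r : ℝ => w ^ 2 * (((r ^ (1 - α) : ℝ) : ℂ) * Complex.exp (-w * r))
        + (-(β:ℂ) ^ 2 + 2 * I * z * β) * (((r ^ (1 - α) : ℝ) : ℂ) * Complex.exp (-(β:ℂ) * r)))
      (volume.restrict (Ioi 0)) := j1.add j2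
  refine ⟨IntegrableOn.congr_fun (j12.add j3) hEq.symm measurableSet_Ioi, ?_⟩
  rw [setIntegral_congr_fun measurableSet_Ioi hEq]
  rw [integral_add j12 j3, integral_add j1 j2, integral_const_mul, integral_const_mul,
    integral_const_mul, v1, v2, v3]
  have hw0 : w ≠ 0 := by rintro h; simp [h] at hwre
  have hb0 : (β:ℂ) ≠ 0 := by exact_mod_cast hβ.ne'
  have hg : Real.Gamma (2 - α + 1) = (2 - α) * Real.Gamma (2 - α) :=
    Real.Gamma_add_one (by linarith)
  rw [hg, show (1 - α + 1 : ℝ) = 2 - α by ring]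
  have c1 : ∀ v : ℂ, v ≠ 0 → v ^ (α:ℂ) = v ^ 2 * v ^ (-(((1 - α : ℝ) : ℂ) + 1)) := by
    intro v hv
    rw [← Complex.cpow_natCast, ← Complex.cpow_add _ _ hv]
    congr 1; push_cast; ring
  have c2 : (β:ℂ) ^ (-(((1 - α : ℝ) : ℂ) + 1)) = β * (β:ℂ) ^ (-(((2 - α : ℝ) : ℂ) + 1)) := by
    nth_rewrite 2 [← Complex.cpow_one (β:ℂ)]
    rw [← Complex.cpow_add _ _ hb0]
    congr 1; push_cast; ring
  have c3 : ((β ^ (α - 1) : ℝ) : ℂ) = β ^ 2 * (β:ℂ) ^ (-(((2 - α : ℝ) : ℂ) + 1)) := by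
    rw [Complex.ofReal_cpow hβ.le, ← Complex.cpow_natCast, ← Complex.cpow_add _ _ hb0]
    congr 1; push_cast; ring
  rw [c1 w hw0, c1 β hb0, c3, c2]
  push_cast
  ring

/-- for `α ∈ (1,2)`, `β > 0`, `z ∈ ℝ`, the function
`r ↦ (e^{izr} − 1 − izr) e^{−βr} r^{−α−1}` is Bochner integrable on `(0,∞)` and
`∫_0^∞ (e^{izr} − 1 − izr) e^{−βr} r^{−α−1} dr
  = Γ(−α)·((β − iz)^α − β^α + izαβ^{α−1})` (principal-branch complex powers). -/
theorem etas_charExponent_alpha_gt_one (α β z : ℝ) (hα : α ∈ Set.Ioo (1:ℝ) 2)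
    (hβ : 0 < β) :
    IntegrableOn (fun r : ℝ =>
        (Complex.exp (Complex.I * z * r) - 1 - Complex.I * z * r) *
          ((Real.exp (-β * r) * r ^ (-α - 1) : ℝ) : ℂ)) (Set.Ioi 0) volume ∧
    (∫ r in Set.Ioi (0:ℝ),
        (Complex.exp (Complex.I * z * r) - 1 - Complex.I * z * r) *
          ((Real.exp (-β * r) * r ^ (-α - 1) : ℝ) : ℂ))
      = (Real.Gamma (-α) : ℂ) *
          (((β : ℂ) - z * Complex.I) ^ (α : ℂ) - (β : ℂ) ^ (α : ℂ)
            + Complex.I * z * α * ((β ^ (α - 1) : ℝ) : ℂ)) := by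
  have hEq : (fun r : ℝ => (Complex.exp (Complex.I * z * r) - 1 - Complex.I * z * r) *
          ((Real.exp (-β * r) * r ^ (-α - 1) : ℝ) : ℂ)) =
      fun r : ℝ => etasG β z r * ((r ^ (-α - 1) : ℝ) : ℂ) := by
    funext r
    unfold etasG
    rw [etas_g_factor, etas_b_factor, show Complex.I * z * r = I * (z * r : ℝ) by push_cast; ring]
    push_cast
    ring
  rw [hEq]
  have hi := etasG_int α β z hα hβ
  obtain ⟨hi2, hv2⟩ := etasG2_int α β z hα hβ
  refine ⟨hi, ?_⟩
  have h1 := hα.1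
  have hi3 := hi2.const_mul (1 / (α * (α - 1)) : ℂ)
  have key := integral_Ioi_of_hasDerivAt_of_tendsto (etasH_cont α β z hα)
    (fun r hr => etasH_deriv α β z r hα hr) (hi.sub hi3) (etasH_top α β z hβ)
  rw [integral_sub hi hi3, integral_const_mul, hv2, etasH_zero α β z hα, sub_zero,
    sub_eq_zero] at key
  rw [key]
  have g1 : Real.Gamma (1 - α) = -α * Real.Gamma (-α) := by
    rw [← Real.Gamma_add_one (by linarith)]; congr 1; ring
  have g2 : Real.Gamma (2 - α) = (1 - α) * Real.Gamma (1 - α) := by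
    rw [← Real.Gamma_add_one (by linarith)]; congr 1; ring
  have h0 : (α:ℂ) ≠ 0 := by exact_mod_cast (by linarith : (0:ℝ) < α).ne'
  have h1' : (α:ℂ) - 1 ≠ 0 := by exact_mod_cast (by linarith : (0:ℝ) < α - 1).ne'
  rw [g2, g1]
  push_cast
  field_simp
  ring
end
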